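/- For all spherical residues R and T of a building X, the combinatorial projection proj_R(T) is the unique maximal spherical residue (with respect to the containment order ≤) that contains R and belongs to the convex hull Conv(R,T). -/

import Mathlib

open Filter Topology

noncomputable section

variable {B : Type} {W : Type} [Group W] {M : CoxeterMatrix B}

/-- The subset `I` of the simple reflections is of *spherical type* if the standard
parabolic subgroup `W_I` it generates is finite. -/
def SphType (cs : CoxeterSystem M W) (I : Set B) : Prop :=
  ((Subgroup.closure (cs.simple '' I) : Subgroup W) : Set W).Finite

/-- A building of type `(W,S)`, in the chamber-system (`W`-metric) approach:
a nonempty set of chambers with a Weyl-group-valued distance function `delta`. -/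
structure Bldg (cs : CoxeterSystem M W) where
  Chamber : Type
  chamber_nonempty : Nonempty Chamber
  delta : Chamber → Chamber → W
  delta_eq_one_iff : ∀ C D, delta C D = 1 ↔ C = D
  delta_mem_pair : ∀ C D E (i : B), delta D E = cs.simple i →
    delta C E = delta C D * cs.simple i ∨ delta C E = delta C D
  delta_eq_of_length : ∀ C D E (i : B), delta D E = cs.simple i →
    cs.length (delta C D * cs.simple i) = cs.length (delta C D) + 1 →
    delta C E = delta C D * cs.simple i
  exists_delta : ∀ C D (i : B), ∃ E, delta D E = cs.simple i ∧
    delta C E = delta C D * cs.simple i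

namespace Bldg

variable {cs : CoxeterSystem M W} (X : Bldg cs)

instance : Nonempty X.Chamber := X.chamber_nonempty

instance : TopologicalSpace X.Chamber := ⊥
instance : DiscreteTopology X.Chamber := ⟨rfl⟩

/-- The gallery distance between two chambers. -/
def gdist (C D : X.Chamber) : ℕ := cs.length (X.delta C D)

/-- The `I`-residue of the chamber `C`. -/
def residue (I : Set B) (C : X.Chamber) : Set X.Chamber :=
  {D | X.delta C D ∈ Subgroup.closure (cs.simple '' I)}

/-- `R` is a spherical residue. -/
def IsSphResidue (R : Set X.Chamber) : Prop :=
  ∃ (I : Set B) (C : X.Chamber), SphType cs I ∧ R = X.residue I C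

/-- `R` is a panel, i.e. an `{s}`-residue. -/
def IsPanel (R : Set X.Chamber) : Prop :=
  ∃ (i : B) (C : X.Chamber), R = X.residue {i} C

/-- The set `Res(X)` of spherical residues of `X`. -/
def Res : Type := {R : Set X.Chamber // X.IsSphResidue R}

/-- The set of panels of `X`. -/
def Panel : Type := {R : Set X.Chamber // X.IsPanel R}

instance : Nonempty X.Res := by
  obtain ⟨C⟩ := X.chamber_nonempty
  exact ⟨⟨X.residue ∅ C, ∅, C, by simp [SphType], rfl⟩⟩

instance : TopologicalSpace X.Res := ⊥
instance : DiscreteTopology X.Res := ⟨rfl⟩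

/-- `R₁ ≤ R₂` : the spherical residue `R₂` contains `R₁`, i.e. `R₂ ⊆ R₁` as
sets of chambers. -/
def leRes (R₁ R₂ : X.Res) : Prop := R₂.1 ⊆ R₁.1

/-- The star `St(σ)` of a spherical residue. -/
def star (σ : X.Res) : Set X.Res := {τ | X.leRes σ τ}

/-- The gate (combinatorial projection) of the chamber `C` onto the residue `R` :
the unique chamber of `R` through which pass minimal galleries from `C` to any
chamber of `R`. -/
def gate (R : Set X.Chamber) (C : X.Chamber) : X.Chamber :=
  Classical.epsilon fun D => D ∈ R ∧ ∀ E ∈ R, X.gdist C E = X.gdist C D + X.gdist D E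

/-- The combinatorial projection of the residue `T` onto the residue `R`,
as a set of chambers. -/
def projSet (R T : Set X.Chamber) : Set X.Chamber := X.gate R '' T

/-- The combinatorial projection `proj_R(T)` of the spherical residue `T` onto
the spherical residue `R`, as a spherical residue. -/
def projRes (R T : X.Res) : X.Res :=
  Classical.epsilon fun U : X.Res => U.1 = X.projSet R.1 T.1

/-- The map `proj_r : Res(X) → ∏_σ St(σ)` underlying the maximal combinatorial
bordification. -/
def projr (R : X.Res) : X.Res → X.Res := fun σ => X.projRes σ R

/-- The maximal combinatorial bordification `Cr(X)`: the closure of the image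
of `proj_r`, each factor of the product being discrete. -/
def Cr : Set (X.Res → X.Res) := closure (Set.range X.projr)

/-- The map `proj_c : ch(X) → ∏_{σ panel} St(σ)` underlying the minimal
combinatorial bordification. -/
def projc (C : X.Chamber) : X.Panel → X.Chamber := fun σ => X.gate σ.1 C

/-- The minimal combinatorial bordification `Cc(X)`. -/
def Cc : Set (X.Panel → X.Chamber) := closure (Set.range X.projc)

/-- A set of spherical residues is closed if it contains, with any residue,
all residues that it contains (in the order `leRes`). -/
def ClosedResSet (𝓡 : Set X.Res) : Prop :=
  ∀ R₁ R₂ : X.Res, X.leRes R₁ R₂ → R₂ ∈ 𝓡 → R₁ ∈ 𝓡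

/-- A set of spherical residues is convex if it is closed and stable under
combinatorial projections. -/
def ConvexResSet (𝓡 : Set X.Res) : Prop :=
  X.ClosedResSet 𝓡 ∧ ∀ R₁ ∈ 𝓡, ∀ R₂ ∈ 𝓡, X.projRes R₁ R₂ ∈ 𝓡

/-- The closure of a set of spherical residues. -/
def resClosure (𝓡 : Set X.Res) : Set X.Res := ⋂₀ {𝓢 | X.ClosedResSet 𝓢 ∧ 𝓡 ⊆ 𝓢}

/-- The convex hull of a set of spherical residues. -/
def convHull (𝓡 : Set X.Res) : Set X.Res := ⋂₀ {𝓢 | X.ConvexResSet 𝓢 ∧ 𝓡 ⊆ 𝓢}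

/-- The convex hull `Conv(R₁,R₂)` of two spherical residues. -/
def conv2 (R₁ R₂ : X.Res) : Set X.Res := X.convHull {R₁, R₂}

/-- `α : W → ch(X)` is an apartment map: an isometric embedding of the Coxeter
complex. -/
def IsApartMap (α : W → X.Chamber) : Prop :=
  Function.Injective α ∧ ∀ v w : W, X.delta (α v) (α w) = v⁻¹ * w

/-- `A` is an apartment of `X`. -/
def IsApartment (A : Set X.Chamber) : Prop :=
  ∃ α : W → X.Chamber, X.IsApartMap α ∧ A = Set.range α

/-- The residue `R` lies in the apartment `A`. -/
def LiesIn (R : X.Res) (A : Set X.Chamber) : Prop := (R.1 ∩ A).Nonempty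

/-- `φ` is a root (half-apartment) of the apartment `A`. -/
def IsRootOf (A φ : Set X.Chamber) : Prop :=
  ∃ α : W → X.Chamber, X.IsApartMap α ∧ A = Set.range α ∧
    ∃ t : W, cs.IsReflection t ∧ φ = α '' {v : W | cs.length v < cs.length (t * v)}

/-- The residue `R` is contained in the root `φ` of the apartment `A`. -/
def ContainedInRoot (R : X.Res) (A φ : Set X.Chamber) : Prop := R.1 ∩ A ⊆ φ

/-- `Φ_A(R₁,R₂)`: the set of roots of `A` containing `R₁` but not `R₂`. -/
def PhiSep (A : Set X.Chamber) (R₁ R₂ : X.Res) : Set (Set X.Chamber) :=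
  {φ | X.IsRootOf A φ ∧ X.ContainedInRoot R₁ A φ ∧ ¬ X.ContainedInRoot R₂ A φ}

/-- A choice of apartment in which both `R₁` and `R₂` lie. -/
def chooseApt (R₁ R₂ : X.Res) : Set X.Chamber :=
  Classical.epsilon fun A : Set X.Chamber => X.IsApartment A ∧ X.LiesIn R₁ A ∧ X.LiesIn R₂ A

/-- The root-distance between two spherical residues:
`d(R₁,R₂) = ½|Φ_A(R₁,R₂)| + ½|Φ_A(R₂,R₁)|` for an apartment `A` containing both. -/
def rootDist (R₁ R₂ : X.Res) : ℝ :=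
  (((X.PhiSep (X.chooseApt R₁ R₂) R₁ R₂).ncard +
    (X.PhiSep (X.chooseApt R₁ R₂) R₂ R₁).ncard : ℕ) : ℝ) / 2

/-- The interval `[R₁,R₂]` determined by two spherical residues. -/
def interval (R₁ R₂ : X.Res) : Set X.Res :=
  {σ | X.rootDist R₁ R₂ = X.rootDist R₁ σ + X.rootDist σ R₂}

/-- The retraction onto the apartment given by the apartment map `α`, centred at
the chamber `α 1`. -/
def retr (α : W → X.Chamber) (D : X.Chamber) : X.Chamber := α (X.delta (α 1) D)

/-- The retraction onto an apartment, acting on spherical residues: it maps the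
`I`-residue of a chamber `D` to the `I`-residue of the retracted chamber. -/
def retrRes (α : W → X.Chamber) (R : X.Res) : X.Res :=
  Classical.epsilon fun T : X.Res =>
    ∃ (I : Set B) (D : X.Chamber), R.1 = X.residue I D ∧ T.1 = X.residue I (X.retr α D)

/-- The sequence `(R_n)` of spherical residues converges to `ξ` in the maximal
combinatorial bordification. -/
def ConvSeq (ξ : X.Res → X.Res) (R : ℕ → X.Res) : Prop :=
  Tendsto (fun n => X.projr (R n)) atTop (nhds ξ)

/-- `Q(x, (R_n)) = ⋃_k ⋂_{n ≥ k} Conv(x, R_n)`. -/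
def Qseq (x : X.Res) (R : ℕ → X.Res) : Set X.Res :=
  ⋃ k : ℕ, ⋂ n : ℕ, ⋂ _ : k ≤ n, X.conv2 x (R n)

/-- The combinatorial sector `Q(x,ξ)` based at `x` and pointing towards `ξ`. -/
def Qsector (x : X.Res) (ξ : X.Res → X.Res) : Set X.Res :=
  X.Qseq x (Classical.epsilon (X.ConvSeq ξ))

/-- `Φ_A(ξ)`: the set of roots of the apartment `A` (with apartment map `α`) in
which every sequence of residues converging to `ξ`, retracted to `A`, eventually
lies. -/
def PhiXi (A : Set X.Chamber) (α : W → X.Chamber) (ξ : X.Res → X.Res) :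
    Set (Set X.Chamber) :=
  {φ | X.IsRootOf A φ ∧ ∀ R : ℕ → X.Res, X.ConvSeq ξ R →
    ∃ N : ℕ, ∀ n > N, X.ContainedInRoot (X.retrRes α (R n)) A φ}

/-- `Φ_A(x)`: the set of roots of `A` containing the residue `x`. -/
def PhiRes (A : Set X.Chamber) (x : X.Res) : Set (Set X.Chamber) :=
  {φ | X.IsRootOf A φ ∧ X.ContainedInRoot x A φ}

/-- The spherical residue `x` is a chamber (an `∅`-residue). -/
def IsChamberRes (x : X.Res) : Prop :=
  ∃ C : X.Chamber, x.1 = X.residue (∅ : Set B) C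

/-- The automorphism group of the building: all permutations of the chambers
preserving the Weyl distance. -/
def autGroup : Subgroup (Equiv.Perm X.Chamber) where
  carrier := {g | ∀ C D : X.Chamber, X.delta (g C) (g D) = X.delta C D}
  one_mem' := by intro C D; simp
  mul_mem' := by
    intro a b ha hb C D
    simp only [Equiv.Perm.mul_apply]
    rw [ha, hb]
  inv_mem' := by
    intro a ha C D
    have := ha (a⁻¹ C) (a⁻¹ D)
    simpa using this.symm

/-- `Aut(X)` as a type. -/
abbrev Aut : Type := ↥X.autGroup

/-- The topology of pointwise convergence on `Aut(X)` (the chamber set being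
discrete). -/
instance : TopologicalSpace X.Aut :=
  TopologicalSpace.induced
    (fun g : X.Aut => ((g : Equiv.Perm X.Chamber) : X.Chamber → X.Chamber)) inferInstance

/-- The action of an automorphism on spherical residues. -/
def actRes (g : X.Aut) (R : X.Res) : X.Res :=
  Classical.epsilon fun T : X.Res => T.1 = (g : Equiv.Perm X.Chamber) '' R.1

/-- The action of an automorphism on panels. -/
def actPanel (g : X.Aut) (σ : X.Panel) : X.Panel :=
  haveI : Nonempty X.Panel := ⟨σ⟩
  Classical.epsilon fun τ : X.Panel => τ.1 = (g : Equiv.Perm X.Chamber) '' σ.1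

/-- The action of `Aut(X)` on the maximal combinatorial bordification:
`(g·f)(σ) = g·f(g⁻¹σ)`. -/
def actCr (g : X.Aut) (f : X.Res → X.Res) : X.Res → X.Res :=
  fun σ => X.actRes g (f (X.actRes g⁻¹ σ))

/-- The action of `Aut(X)` on the minimal combinatorial bordification. -/
def actCc (g : X.Aut) (f : X.Panel → X.Chamber) : X.Panel → X.Chamber :=
  fun σ => (g : Equiv.Perm X.Chamber) (f (X.actPanel g⁻¹ σ))

/-- The building is locally finite: `S` is finite and panels are finite. -/
def LocallyFinite : Prop :=
  Finite B ∧ ∀ R : Set X.Chamber, X.IsPanel R → R.Finite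

/-- The building is thick: every panel contains at least three chambers. -/
def Thick : Prop := ∀ R : Set X.Chamber, X.IsPanel R → 3 ≤ R.ncard

/-- The subgroup `G ≤ Aut(X)` acts strongly transitively: transitively on pairs
`(C, A)` of a chamber contained in an apartment. -/
def StronglyTransitive (G : Subgroup X.Aut) : Prop :=
  ∀ (C C' : X.Chamber) (A A' : Set X.Chamber),
    X.IsApartment A → C ∈ A → X.IsApartment A' → C' ∈ A' →
    ∃ g ∈ G, (g : Equiv.Perm X.Chamber) C = C' ∧ (g : Equiv.Perm X.Chamber) '' A = A'

end Bldg

/-- A topological group is amenable if there is a left-invariant mean on the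
space of bounded continuous real-valued functions on it. -/
def IsAmenableGroup (H : Type*) [Group H] [TopologicalSpace H] : Prop :=
  ∃ m : BoundedContinuousFunction H ℝ →ₗ[ℝ] ℝ,
    m 1 = 1 ∧ (∀ f : BoundedContinuousFunction H ℝ, (∀ x, 0 ≤ f x) → 0 ≤ m f) ∧
    ∀ (g : H) (f₁ f₂ : BoundedContinuousFunction H ℝ),
      (∀ x, f₂ x = f₁ (g * x)) → m f₂ = m f₁

/-- A subset `K` of a topological group is topologically locally finite if every
finite subset of `K` generates a subgroup with compact closure. -/
def IsTLFSet {H : Type*} [Group H] [TopologicalSpace H] (K : Set H) : Prop :=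
  ∀ s : Finset H, (s : Set H) ⊆ K →
    IsCompact (closure ((Subgroup.closure (s : Set H) : Subgroup H) : Set H))

/-- The space of closed subgroups of a topological group. -/
def ChabautySpace (H : Type*) [Group H] [TopologicalSpace H] : Type _ :=
  {K : Subgroup H // IsClosed (K : Set H)}

instance {H : Type*} [Group H] [TopologicalSpace H] : Nonempty (ChabautySpace H) :=
  ⟨⟨⊤, by rw [Subgroup.coe_top]; exact isClosed_univ⟩⟩

/-- The Chabauty topology on the space of closed subgroups. -/
instance {H : Type*} [Group H] [TopologicalSpace H] : TopologicalSpace (ChabautySpace H) :=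
  TopologicalSpace.generateFrom
    ({s | ∃ K : Set H, IsCompact K ∧ s = {L : ChabautySpace H | (L.1 : Set H) ∩ K = ∅}} ∪
     {s | ∃ U : Set H, IsOpen U ∧ s = {L : ChabautySpace H | ((L.1 : Set H) ∩ U).Nonempty}})

namespace Bldg

variable {cs : CoxeterSystem M W} (X : Bldg cs)

/-- The stabiliser in `G` of a spherical residue, as a set. -/
def gstab (G : Subgroup X.Aut) (R : X.Res) : Set ↥G :=
  {g : ↥G | X.actRes (g : X.Aut) R = R}

/-- The stabiliser in `G` of a spherical residue, as a closed subgroup of `G`. -/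
def gstabC (G : Subgroup X.Aut) (R : X.Res) : ChabautySpace ↥G :=
  Classical.epsilon fun L : ChabautySpace ↥G => (L.1 : Set ↥G) = X.gstab G R

/-- `D_ξ`: the union over `x ∈ Res(X)` of the pointwise fixators in `G` of the
combinatorial sectors `Q(x,ξ)`. -/
def gfixSector (G : Subgroup X.Aut) (ξ : X.Res → X.Res) : Set ↥G :=
  {g : ↥G | ∃ x : X.Res, ∀ R ∈ X.Qsector x ξ, X.actRes (g : X.Aut) R = R}

/-- `D_ξ` as a closed subgroup of `G` (an element of the Chabauty space). -/
def DxiC (G : Subgroup X.Aut) (ξ : X.Res → X.Res) : ChabautySpace ↥G :=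
  Classical.epsilon fun L : ChabautySpace ↥G => (L.1 : Set ↥G) = X.gfixSector G ξ

/-- The set of periodic elements of the stabiliser `G_ξ`. -/
def periodicStab (G : Subgroup X.Aut) (ξ : X.Res → X.Res) : Set ↥G :=
  {g : ↥G | X.actCr (g : X.Aut) ξ = ξ ∧
    IsCompact (closure ((Subgroup.zpowers g : Subgroup ↥G) : Set ↥G))}

/-- The horofunction compactification of the chamber graph, with base point `y₀`. -/
def horoCh (y₀ : X.Chamber) : Set (X.Chamber → ℝ) :=
  closure (Set.range fun C : X.Chamber =>
    fun y : X.Chamber => (X.gdist C y : ℝ) - (X.gdist C y₀ : ℝ))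

/-- The horofunction compactification of `(Res(X), root-distance)`, with base
point `z₀`. -/
def horoRes (z₀ : X.Res) : Set (X.Res → ℝ) :=
  closure (Set.range fun R : X.Res =>
    fun y : X.Res => X.rootDist R y - X.rootDist R z₀)

/-- The action of `Aut(X)` on horofunctions of the chamber graph. -/
def actHoroCh (y₀ : X.Chamber) (g : X.Aut) (h : X.Chamber → ℝ) : X.Chamber → ℝ :=
  fun y => h (((g⁻¹ : X.Aut) : Equiv.Perm X.Chamber) y) -
    h (((g⁻¹ : X.Aut) : Equiv.Perm X.Chamber) y₀)

/-- The action of `Aut(X)` on horofunctions of `(Res(X), root-distance)`. -/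
def actHoroRes (z₀ : X.Res) (g : X.Aut) (h : X.Res → ℝ) : X.Res → ℝ :=
  fun y => h (X.actRes g⁻¹ y) - h (X.actRes g⁻¹ z₀)

end Bldg

namespace CoxeterSystem

variable (cs : CoxeterSystem M W)

open Classical in
/-- Conjugation by a simple reflection on `W × ZMod 2`, changing the sign exactly over
that reflection. -/
def signedConj (i : B) : Function.End (W × ZMod 2) :=
  fun p => (cs.simple i * p.1 * cs.simple i, p.2 + if p.1 = cs.simple i then 1 else 0)

lemma simple_mul_rotation_pow (i j : B) (n : ℕ) :
    (cs.simple j * cs.simple i) ^ n * cs.simple j =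
      cs.simple j * (cs.simple i * cs.simple j) ^ n := by
  induction n with
  | zero => simp
  | succ n ih => rw [pow_succ', mul_assoc, ih, pow_succ']; simp only [mul_assoc]

lemma rotation_pow_mul_rotation_pow (i j : B) (n : ℕ) :
    (cs.simple j * cs.simple i) ^ n * (cs.simple i * cs.simple j) ^ n = 1 := by
  have h : cs.simple j * cs.simple i = (cs.simple i * cs.simple j)⁻¹ := by simp
  rw [h, inv_pow, inv_mul_cancel]

open Classical in
lemma signedConj_mul_pow (i j : B) (n : ℕ) (p : W × ZMod 2) :
    ((cs.signedConj i * cs.signedConj j) ^ n) p =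
      ((cs.simple i * cs.simple j) ^ n * p.1 * (cs.simple j * cs.simple i) ^ n,
        p.2 + ∑ k ∈ Finset.range (2 * n),
          if p.1 = cs.simple j * (cs.simple i * cs.simple j) ^ k then 1 else 0) := by
  induction n with
  | zero => simp; rfl
  | succ n ih =>
    have hr := cs.rotation_pow_mul_rotation_pow i j n
    have hr' := cs.rotation_pow_mul_rotation_pow j i n
    have hs := cs.simple_mul_rotation_pow i j n
    set a := cs.simple i
    set b := cs.simple j
    have hb : b * b = 1 := cs.simple_mul_simple_self j
    have hinv : ((b * a) ^ n)⁻¹ = (a * b) ^ n := inv_eq_of_mul_eq_one_right hr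
    have hinv' : ((a * b) ^ n)⁻¹ = (b * a) ^ n := inv_eq_of_mul_eq_one_right hr'
    have hbinv : b⁻¹ = b := cs.inv_simple j
    have h1 : (a * b) ^ n * p.1 * (b * a) ^ n = b ↔ p.1 = b * (a * b) ^ (2 * n) := by
      rw [mul_assoc, ← eq_inv_mul_iff_mul_eq, ← eq_mul_inv_iff_mul_eq, hinv, hinv', hs,
        mul_assoc, ← pow_add, two_mul]
    have h2 : b * ((a * b) ^ n * p.1 * (b * a) ^ n) * b = a ↔
        p.1 = b * (a * b) ^ (2 * n + 1) := by
      rw [mul_assoc b, ← eq_inv_mul_iff_mul_eq, ← eq_mul_inv_iff_mul_eq, hbinv,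
        mul_assoc _ p.1, ← eq_inv_mul_iff_mul_eq, ← eq_mul_inv_iff_mul_eq, hinv, hinv',
        pow_succ, two_mul, pow_add]
      have h3 : (b * a) ^ n * (b * a * b) * (a * b) ^ n =
          b * ((a * b) ^ n * (a * b) ^ n * (a * b)) := by
        rw [mul_assoc b a b, ← mul_assoc _ b, hs]
        simp only [mul_assoc]
        rw [← mul_assoc a b, ← pow_succ', pow_succ]
      rw [← h3]
    rw [pow_succ', Nat.mul_succ, Finset.sum_range_succ, Finset.sum_range_succ]
    change cs.signedConj i (cs.signedConj j (((cs.signedConj i * cs.signedConj j) ^ n) p)) = _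
    rw [ih]
    simp only [signedConj]
    change (a * (b * ((a * b) ^ n * p.1 * (b * a) ^ n) * b) * a, _) = _
    refine Prod.ext ?_ ?_
    · simp only [pow_succ', pow_succ (b * a), mul_assoc]
    · simp only
      rw [← add_assoc, ← add_assoc]
      congr 1
      · congr 1
        exact if_congr h1 rfl rfl
      · exact if_congr h2 rfl rfl

lemma signedConj_isLiftable : M.IsLiftable cs.signedConj := by
  classical
  intro i j
  funext p
  have h : (cs.simple j * cs.simple i) ^ M i j = 1 := by simp
  rw [signedConj_mul_pow, two_mul, Finset.sum_range_add]
  simp only [pow_add, cs.simple_mul_simple_pow, h, one_mul, mul_one, CharTwo.add_self_eq_zero,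
    add_zero]
  rfl

/-- The sign cocycle: `1` if the reflection `t` is a left inversion of `w`, and `0` otherwise. -/
def signCocycle (w t : W) : ZMod 2 :=
  (cs.lift ⟨cs.signedConj, cs.signedConj_isLiftable⟩ w⁻¹ (t, 0)).2

lemma lift_signedConj_apply (w t : W) (e : ZMod 2) :
    cs.lift ⟨cs.signedConj, cs.signedConj_isLiftable⟩ w (t, e) =
      (w * t * w⁻¹, e + cs.signCocycle w⁻¹ t) := by
  rw [signCocycle, inv_inv]
  induction w using cs.simple_induction_left generalizing e with
  | one =>
    rw [map_one]
    change (t, e) = (1 * t * 1⁻¹, e + 0)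
    simp
  | mul_simple_left w i ih =>
    rw [map_mul, cs.lift_apply_simple]
    change cs.signedConj i (cs.lift ⟨cs.signedConj, cs.signedConj_isLiftable⟩ w (t, e)) =
      (_, e + (cs.signedConj i
        (cs.lift ⟨cs.signedConj, cs.signedConj_isLiftable⟩ w (t, 0))).2)
    rw [ih e, ih 0]
    simp [signedConj, mul_assoc, add_assoc]

lemma signCocycle_one (t : W) : cs.signCocycle 1 t = 0 := by
  simp [signCocycle]; rfl

lemma signCocycle_mul (a b t : W) :
    cs.signCocycle (a * b) t = cs.signCocycle a t + cs.signCocycle b (a⁻¹ * t * a) := by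
  conv_lhs => rw [signCocycle, mul_inv_rev, map_mul]
  change (cs.lift ⟨cs.signedConj, cs.signedConj_isLiftable⟩ b⁻¹
    (cs.lift ⟨cs.signedConj, cs.signedConj_isLiftable⟩ a⁻¹ (t, 0))).2 = _
  rw [lift_signedConj_apply, lift_signedConj_apply]
  simp

open Classical in
lemma signCocycle_simple (i : B) (t : W) :
    cs.signCocycle (cs.simple i) t = if t = cs.simple i then 1 else 0 := by
  simp [signCocycle, cs.lift_apply_simple, signedConj]

lemma signCocycle_self {t : W} (ht : cs.IsReflection t) : cs.signCocycle t t = 1 := by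
  classical
  obtain ⟨u, i, rfl⟩ := ht
  have h := cs.signCocycle_mul u u⁻¹ (u * cs.simple i * u⁻¹)
  rw [mul_inv_cancel, signCocycle_one] at h
  rw [signCocycle_mul, signCocycle_mul]
  simp only [mul_inv_rev, mul_assoc, inv_mul_cancel_left, inv_mul_cancel, mul_one,
    inv_simple, simple_mul_simple_self, signCocycle_simple] at h ⊢
  simp
  rw [add_right_comm, ← h, zero_add]

lemma mem_leftInvSeq_of_signCocycle (ω : List B) (t : W)
    (h : cs.signCocycle (cs.wordProd ω) t = 1) : t ∈ cs.leftInvSeq ω := by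
  classical
  induction ω generalizing t with
  | nil => simp [signCocycle_one] at h
  | cons i ω ih =>
    rw [wordProd_cons, signCocycle_mul, signCocycle_simple] at h
    by_cases hti : t = cs.simple i
    · simp [leftInvSeq, hti]
    · rw [if_neg hti, zero_add] at h
      rw [leftInvSeq, List.mem_cons, List.mem_map]
      refine Or.inr ⟨_, ih _ h, ?_⟩
      simp [mul_assoc]

lemma signCocycle_eq_one_iff {t : W} (ht : cs.IsReflection t) (w : W) :
    cs.signCocycle w t = 1 ↔ cs.length (t * w) < cs.length w := by
  have key : ∀ w, cs.signCocycle w t = 1 → cs.length (t * w) < cs.length w := by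
    intro w h
    obtain ⟨ω, hω, rfl⟩ := cs.exists_isReduced w
    exact (cs.isLeftInversion_of_mem_leftInvSeq hω (cs.mem_leftInvSeq_of_signCocycle ω t h)).2
  refine ⟨key w, fun h => ?_⟩
  by_contra hne
  have h0 : cs.signCocycle w t = 0 := by
    generalize cs.signCocycle w t = x at hne
    revert x; decide
  have h1 := key (t * w) (by
    rw [signCocycle_mul, cs.signCocycle_self ht]
    simp [h0])
  rw [← mul_assoc, ht.mul_self, one_mul] at h1
  omega

/-- A reflection is a left inversion of a product `a * b` iff it is an inversion of exactly one of
`a` and (after conjugation) `b`. -/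
lemma length_reflection_mul_lt_iff {t : W} (ht : cs.IsReflection t) (a b : W) :
    cs.length (t * (a * b)) < cs.length (a * b) ↔
      ¬ (cs.length (t * a) < cs.length a ↔ cs.length (a⁻¹ * t * a * b) < cs.length b) := by
  have ht' : cs.IsReflection (a⁻¹ * t * a) := by simpa using ht.conj a⁻¹
  rw [← cs.signCocycle_eq_one_iff ht, ← cs.signCocycle_eq_one_iff ht,
    ← cs.signCocycle_eq_one_iff ht', signCocycle_mul]
  generalize cs.signCocycle a t = x
  generalize cs.signCocycle b _ = y
  revert x y; decide

lemma exists_eraseIdx_of_length_lt {t : W} (ht : cs.IsReflection t) (ω : List B)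
    (h : cs.length (t * cs.wordProd ω) < cs.length (cs.wordProd ω)) :
    ∃ j < ω.length, t * cs.wordProd ω = cs.wordProd (ω.eraseIdx j) := by
  have hmem := cs.mem_leftInvSeq_of_signCocycle ω t ((cs.signCocycle_eq_one_iff ht _).2 h)
  obtain ⟨j, hj, rfl⟩ := List.mem_iff_getElem.mp hmem
  refine ⟨j, by simpa using hj, ?_⟩
  rw [← List.getD_eq_getElem _ 1 hj, getD_leftInvSeq_mul_wordProd]

lemma length_inv_mul_lt_of_common_leftDescent {v w : W} {i : B}
    (hv : cs.length (cs.simple i * v) < cs.length v)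
    (hw : cs.length (cs.simple i * w) < cs.length w) :
    cs.length (v⁻¹ * w) < cs.length (v⁻¹ * cs.simple i * w) := by
  have ht : cs.IsReflection (v⁻¹ * cs.simple i * v) := by
    simpa using (cs.isReflection_simple i).conj v⁻¹
  have h1 := cs.length_reflection_mul_lt_iff ht v⁻¹ w
  have h2 := ht.length_mul_right_ne (v⁻¹ * w)
  have h3 : v⁻¹ * cs.simple i * v * (v⁻¹ * w) = v⁻¹ * cs.simple i * w := by group
  have h4 : cs.length (v⁻¹ * cs.simple i * v * v⁻¹) < cs.length v⁻¹ := by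
    rw [mul_inv_cancel_right, ← cs.length_inv, mul_inv_rev, inv_inv, cs.inv_simple,
      cs.length_inv]
    exact hv
  have h5 : v⁻¹⁻¹ * (v⁻¹ * cs.simple i * v) * v⁻¹ * w = cs.simple i * w := by group
  rw [h3, h5] at h1
  rw [h3] at h2
  have h6 : ¬ cs.length (v⁻¹ * cs.simple i * w) < cs.length (v⁻¹ * w) :=
    fun h => h1.1 h (iff_of_true h4 hw)
  omega

/-- The standard parabolic subgroup generated by `I`. -/
abbrev parabolic (I : Set B) : Subgroup W := Subgroup.closure (cs.simple '' I)

variable {cs}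

lemma simple_mem_parabolic {I : Set B} {i : B} (hi : i ∈ I) : cs.simple i ∈ cs.parabolic I :=
  Subgroup.subset_closure (Set.mem_image_of_mem _ hi)

lemma parabolic_mono {I J : Set B} (h : I ⊆ J) : cs.parabolic I ≤ cs.parabolic J :=
  Subgroup.closure_mono (Set.image_mono h)

lemma conj_mem_parabolic {K J : Set B} {w v : W}
    (hK : ∀ k ∈ K, w⁻¹ * cs.simple k * w ∈ cs.parabolic J) (hv : v ∈ cs.parabolic K) :
    w⁻¹ * v * w ∈ cs.parabolic J := by
  have h : cs.parabolic K ≤ (cs.parabolic J).comap (MulAut.conj w⁻¹).toMonoidHom := by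
    rw [parabolic, Subgroup.closure_le]
    rintro _ ⟨k, hk, rfl⟩
    simpa using hK k hk
  simpa using h hv

lemma exists_isReduced_of_word_mem {I : Set B} (ω : List B) (hω : ∀ i ∈ ω, i ∈ I) :
    ∃ ω' : List B, (∀ i ∈ ω', i ∈ I) ∧ cs.IsReduced ω' ∧ cs.wordProd ω = cs.wordProd ω' := by
  induction ω with
  | nil => exact ⟨[], by simp, by simp [IsReduced], rfl⟩
  | cons i ω ih =>
    obtain ⟨ω', hI, hred, heq⟩ := ih fun j hj => hω j (List.mem_cons_of_mem _ hj)
    have hi : i ∈ I := hω i List.mem_cons_self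
    rcases cs.length_simple_mul (cs.wordProd ω') i with h | h
    · refine ⟨i :: ω', by simpa [hi] using hI, ?_, by rw [wordProd_cons, wordProd_cons, heq]⟩
      rw [IsReduced, wordProd_cons, h, hred.eq, List.length_cons]
    · obtain ⟨j, hj, he⟩ := cs.exists_eraseIdx_of_length_lt (cs.isReflection_simple i) ω'
        (by omega)
      refine ⟨ω'.eraseIdx j, fun k hk => hI k (List.mem_of_mem_eraseIdx hk), ?_, ?_⟩
      · rw [IsReduced, ← he]
        have := List.length_eraseIdx_add_one hj
        have := hred.eq
        omega
      · rw [wordProd_cons, heq, he]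

lemma exists_isReduced_of_mem_parabolic {I : Set B} {v : W} (hv : v ∈ cs.parabolic I) :
    ∃ ω : List B, (∀ i ∈ ω, i ∈ I) ∧ cs.IsReduced ω ∧ v = cs.wordProd ω := by
  suffices h : ∃ ω : List B, (∀ i ∈ ω, i ∈ I) ∧ v = cs.wordProd ω by
    obtain ⟨ω, hI, rfl⟩ := h
    exact exists_isReduced_of_word_mem ω hI
  induction hv using Subgroup.closure_induction with
  | mem x hx =>
    obtain ⟨i, hi, rfl⟩ := hx
    exact ⟨[i], by simpa using hi, by simp⟩
  | one => exact ⟨[], by simp, by simp⟩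
  | mul x y _ _ hx hy =>
    obtain ⟨ω, h, rfl⟩ := hx
    obtain ⟨ω', h', rfl⟩ := hy
    refine ⟨ω ++ ω', fun i hi => ?_, by rw [wordProd_append]⟩
    rcases List.mem_append.1 hi with hi | hi
    exacts [h i hi, h' i hi]
  | inv x _ hx =>
    obtain ⟨ω, h, rfl⟩ := hx
    exact ⟨ω.reverse, fun i hi => h i (List.mem_reverse.1 hi), by rw [wordProd_reverse]⟩

/-- Induction over the elements of a standard parabolic subgroup along reduced words, multiplying
on the left. -/
lemma parabolic_induction_left {I : Set B} {p : W → Prop} (one : p 1)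
    (step : ∀ i ∈ I, ∀ v ∈ cs.parabolic I, cs.length (cs.simple i * v) = cs.length v + 1 →
      p v → p (cs.simple i * v)) {v : W} (hv : v ∈ cs.parabolic I) : p v := by
  obtain ⟨ω, hI, hred, rfl⟩ := exists_isReduced_of_mem_parabolic hv
  clear hv
  induction ω with
  | nil => simpa using one
  | cons i ω ih =>
    have hred' : cs.IsReduced ω := by simpa using hred.drop 1
    have hI' : ∀ j ∈ ω, j ∈ I := fun j hj => hI j (List.mem_cons_of_mem _ hj)
    rw [wordProd_cons]
    refine step i (hI i List.mem_cons_self) _ ?_ ?_ (ih hI' hred')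
    · exact Subgroup.list_prod_mem _ (by
        intro x hx
        obtain ⟨j, hj, rfl⟩ := List.mem_map.1 hx
        exact simple_mem_parabolic (hI' j hj))
    · rw [← wordProd_cons, hred.eq, hred'.eq, List.length_cons]

/-- Induction over the elements of a standard parabolic subgroup along reduced words, multiplying
on the right. -/
lemma parabolic_induction_right {I : Set B} {p : W → Prop} (one : p 1)
    (step : ∀ i ∈ I, ∀ v ∈ cs.parabolic I, cs.length (v * cs.simple i) = cs.length v + 1 →
      p v → p (v * cs.simple i)) {v : W} (hv : v ∈ cs.parabolic I) : p v := by
  suffices h : p (v⁻¹)⁻¹ by simpa using h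
  refine parabolic_induction_left (p := fun u => p u⁻¹) (by simpa using one) ?_ (inv_mem hv)
  intro i hi u hu hlen hp
  rw [mul_inv_rev, inv_simple]
  refine step i hi _ (inv_mem hu) ?_ hp
  rw [← length_inv, mul_inv_rev, inv_inv, inv_simple, hlen, length_inv]

/-- `x` has minimal length in its coset `W_I x`. -/
def IsLeftMin (cs : CoxeterSystem M W) (I : Set B) (x : W) : Prop :=
  ∀ v ∈ cs.parabolic I, cs.length x ≤ cs.length (v * x)

lemma IsLeftMin.length_mul {I : Set B} {x : W} (hx : cs.IsLeftMin I x) {v : W}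
    (hv : v ∈ cs.parabolic I) : cs.length (v * x) = cs.length v + cs.length x := by
  refine parabolic_induction_left (cs := cs)
    (p := fun v => cs.length (v * x) = cs.length v + cs.length x) (by simp) ?_ hv
  intro i hi v hv hlen ih
  rw [hlen, mul_assoc]
  rcases cs.length_simple_mul (v * x) i with h | h
  · omega
  · have h1 := (cs.length_reflection_mul_lt_iff (cs.isReflection_simple i) v x).1 (by omega)
    have h2 : v⁻¹ * cs.simple i * v ∈ cs.parabolic I :=
      mul_mem (mul_mem (inv_mem hv) (simple_mem_parabolic hi)) hv
    have h3 := hx _ h2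
    exact absurd (iff_of_false (by omega) (by omega)) h1

lemma exists_isLeftMin (I : Set B) (x : W) : ∃ v ∈ cs.parabolic I, cs.IsLeftMin I (v⁻¹ * x) := by
  obtain ⟨v, hv, hmin⟩ := exists_minimalFor_of_wellFoundedLT
    (fun v : W => v ∈ cs.parabolic I) (fun v => cs.length (v⁻¹ * x)) ⟨1, one_mem _⟩
  refine ⟨v, hv, fun u hu => ?_⟩
  have hmem : v * u⁻¹ ∈ cs.parabolic I := mul_mem hv (inv_mem hu)
  by_contra hlt
  have := hmin hmem (by simp only [mul_inv_rev, inv_inv, mul_assoc]; omega)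
  simp only [mul_inv_rev, inv_inv, mul_assoc] at this
  omega

lemma isLeftMin_of_simple {I : Set B} {x : W}
    (h : ∀ i ∈ I, cs.length x ≤ cs.length (cs.simple i * x)) : cs.IsLeftMin I x := by
  obtain ⟨v, hv, hmin⟩ := exists_isLeftMin (cs := cs) I x
  have key : ∀ y, cs.IsLeftMin I y → x = v * y → v = 1 := by
    intro y hy hxy
    subst hxy
    revert h
    refine parabolic_induction_left (cs := cs) (p := fun v =>
      (∀ i ∈ I, cs.length (v * y) ≤ cs.length (cs.simple i * (v * y))) → v = 1)
      (by simp) ?_ hv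
    intro i hi u hu hlen _ hle
    have h1 := hle i hi
    rw [hy.length_mul (mul_mem (simple_mem_parabolic hi) hu), mul_assoc,
      simple_mul_simple_cancel_left, hy.length_mul hu] at h1
    omega
  have h1 := key _ hmin (by simp)
  simpa [h1] using hmin

lemma IsLeftMin.eq_one_of_mul {I : Set B} {x v : W} (hx : cs.IsLeftMin I x)
    (hv : v ∈ cs.parabolic I) (hvx : cs.IsLeftMin I (v * x)) : v = 1 := by
  have h1 := hx.length_mul hv
  have h2 := hvx _ (inv_mem hv)
  rw [inv_mul_cancel_left] at h2
  exact cs.length_eq_zero_iff.1 (by omega)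

/-- Deodhar's lemma. -/
lemma IsLeftMin.mul_simple {I : Set B} {x : W} (hx : cs.IsLeftMin I x) (j : B) :
    cs.IsLeftMin I (x * cs.simple j) ∨ ∃ i ∈ I, x * cs.simple j = cs.simple i * x := by
  by_contra! hne
  refine hne.1 (isLeftMin_of_simple fun i hi => ?_)
  by_contra hlt
  have h1 := (cs.length_reflection_mul_lt_iff (cs.isReflection_simple i) x (cs.simple j)).1
    (by omega)
  have h2 := hx _ (simple_mem_parabolic hi)
  have h3 : cs.length (x⁻¹ * cs.simple i * x * cs.simple j) < cs.length (cs.simple j) := by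
    by_contra h3
    exact h1 (iff_of_false (by omega) h3)
  rw [length_simple, Nat.lt_one_iff, length_eq_zero_iff, mul_eq_one_iff_eq_inv, inv_simple,
    mul_assoc, inv_mul_eq_iff_eq_mul] at h3
  exact hne.2 i hi h3.symm

/-- Every element of `w W_J`, with `w` minimal in `W_I w`, is reduced to a minimal element of its
`W_I`-coset by an element of the parabolic subgroup `W_K`, where `K` consists of the simple
reflections of `I` which `w` conjugates into `W_J`. -/
lemma IsLeftMin.exists_mem_parabolic {I J : Set B} {w : W} (hw : cs.IsLeftMin I w) {u : W}
    (hu : u ∈ cs.parabolic J) :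
    ∃ v ∈ cs.parabolic {i ∈ I | w⁻¹ * cs.simple i * w ∈ cs.parabolic J},
      cs.IsLeftMin I (v⁻¹ * w * u) := by
  set K : Set B := {i ∈ I | w⁻¹ * cs.simple i * w ∈ cs.parabolic J} with hK
  refine parabolic_induction_right (cs := cs) (p := fun u =>
    ∃ v ∈ cs.parabolic K, cs.IsLeftMin I (v⁻¹ * w * u)) ⟨1, one_mem _, by simpa using hw⟩ ?_ hu
  rintro j hj u hu - ⟨v, hv, hmin⟩
  rcases hmin.mul_simple j with h | ⟨i, hi, h⟩
  · exact ⟨v, hv, by rwa [← mul_assoc]⟩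
  · have hconj : w⁻¹ * v * w ∈ cs.parabolic J := conj_mem_parabolic (fun k hk => hk.2) hv
    have hiK : i ∈ K := by
      refine ⟨hi, ?_⟩
      have h' : w⁻¹ * cs.simple i * w =
          (w⁻¹ * v * w)⁻¹ * (u * cs.simple j * u⁻¹) * (w⁻¹ * v * w) := by
        rw [← mul_inv_eq_iff_eq_mul] at h
        rw [← h]
        group
      rw [h']
      exact mul_mem (mul_mem (inv_mem hconj)
        (mul_mem (mul_mem hu (simple_mem_parabolic hj)) (inv_mem hu))) hconj
    refine ⟨v * cs.simple i, mul_mem hv (simple_mem_parabolic hiK), ?_⟩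
    have h'' : (v * cs.simple i)⁻¹ * w * (u * cs.simple j) = v⁻¹ * w * u := by
      rw [mul_inv_rev, inv_simple, mul_assoc, mul_assoc, ← mul_assoc w, ← mul_assoc v⁻¹,
        ← mul_assoc v⁻¹, h, simple_mul_simple_cancel_left]
    rwa [h'']

/-- Induction over a Coxeter group along reduced words, multiplying on the right. -/
lemma reduced_induction_right {p : W → Prop} (one : p 1)
    (step : ∀ i v, cs.length (v * cs.simple i) = cs.length v + 1 → p v → p (v * cs.simple i))
    (v : W) : p v := by
  have hv : v ∈ cs.parabolic Set.univ := by
    rw [parabolic, Set.image_univ, subgroup_closure_range_simple]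
    exact Subgroup.mem_top v
  exact parabolic_induction_right one (fun i _ v _ => step i v) hv

/-- Induction over a Coxeter group along reduced words, multiplying on the left. -/
lemma reduced_induction_left {p : W → Prop} (one : p 1)
    (step : ∀ i v, cs.length (cs.simple i * v) = cs.length v + 1 → p v → p (cs.simple i * v))
    (v : W) : p v := by
  have hv : v ∈ cs.parabolic Set.univ := by
    rw [parabolic, Set.image_univ, subgroup_closure_range_simple]
    exact Subgroup.mem_top v
  exact parabolic_induction_left one (fun i _ v _ => step i v) hv

end CoxeterSystem

namespace Bldg

variable {cs : CoxeterSystem M W} {X : Bldg cs}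

open CoxeterSystem

lemma delta_self (C : X.Chamber) : X.delta C C = 1 := (X.delta_eq_one_iff C C).2 rfl

lemma delta_swap_of_simple {C D : X.Chamber} {i : B} (h : X.delta C D = cs.simple i) :
    X.delta D C = cs.simple i := by
  have hne : cs.simple i ≠ 1 := by
    rw [Ne, ← cs.length_eq_zero_iff, cs.length_simple]; omega
  rcases X.delta_mem_pair D C D i h with h1 | h1
  · rw [delta_self, eq_comm, mul_eq_one_iff_eq_inv, cs.inv_simple] at h1
    exact h1
  · rw [delta_self, eq_comm, X.delta_eq_one_iff] at h1
    rw [h1, delta_self] at h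
    exact absurd h.symm hne

/-- A chamber at Weyl distance `v * s` is adjacent to one at Weyl distance `v`. -/
lemma exists_adjacent {C E : X.Chamber} {v : W} {i : B} (h : X.delta C E = v * cs.simple i) :
    ∃ E', X.delta E' E = cs.simple i ∧ X.delta C E' = v := by
  obtain ⟨E', h1, h2⟩ := X.exists_delta C E i
  refine ⟨E', delta_swap_of_simple h1, ?_⟩
  rw [h2, h, cs.simple_mul_simple_cancel_right]

lemma delta_mul_of_length {C D E : X.Chamber}
    (h : cs.length (X.delta C D * X.delta D E) =
      cs.length (X.delta C D) + cs.length (X.delta D E)) :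
    X.delta C E = X.delta C D * X.delta D E := by
  suffices H : ∀ v E, X.delta D E = v →
      cs.length (X.delta C D * v) = cs.length (X.delta C D) + cs.length v →
      X.delta C E = X.delta C D * v from H _ E rfl h
  intro v
  induction v using reduced_induction_right (cs := cs) with
  | one =>
    intro E hE _
    rw [X.delta_eq_one_iff] at hE
    rw [hE, mul_one]
  | step i v hlen ih =>
    intro E hE hl
    obtain ⟨E', h1, h2⟩ := exists_adjacent hE
    have h3 := cs.length_mul_le (X.delta C D) v
    have h4 := cs.length_mul_le (X.delta C D * v) (cs.simple i)
    rw [cs.length_simple] at h4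
    rw [← mul_assoc] at hl ⊢
    have h5 := ih E' h2 (by omega)
    rw [← h5]
    exact X.delta_eq_of_length C E' E i h1 (by rw [h5]; omega)

lemma delta_swap (C D : X.Chamber) : X.delta D C = (X.delta C D)⁻¹ := by
  suffices H : ∀ v D, X.delta C D = v → X.delta D C = v⁻¹ from H _ D rfl
  intro v
  induction v using reduced_induction_right (cs := cs) with
  | one =>
    intro D h
    rw [X.delta_eq_one_iff] at h
    rw [h, delta_self, inv_one]
  | step i v hlen ih =>
    intro D h
    obtain ⟨D', h1, h2⟩ := exists_adjacent h
    have h3 := ih D' h2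
    have h4 := delta_swap_of_simple h1
    rw [delta_mul_of_length (D := D'), h3, h4, mul_inv_rev, cs.inv_simple]
    rw [h3, h4, cs.length_simple, ← cs.length_inv, mul_inv_rev, inv_inv, cs.inv_simple, hlen,
      cs.length_inv, add_comm]

lemma gdist_swap (C D : X.Chamber) : X.gdist C D = X.gdist D C := by
  rw [gdist, gdist, delta_swap, cs.length_inv]

lemma gdist_self (C : X.Chamber) : X.gdist C C = 0 := by
  rw [gdist, delta_self, cs.length_one]

lemma eq_of_gdist_eq_zero {C D : X.Chamber} (h : X.gdist C D = 0) : C = D :=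
  (X.delta_eq_one_iff C D).1 (cs.length_eq_zero_iff.1 h)

lemma exists_delta_eq_mul (C D E : X.Chamber) : ∃ z, X.delta C E = X.delta C D * z ∧
    (z = X.delta D E ∨ cs.length z < cs.length (X.delta D E)) := by
  suffices H : ∀ v E, X.delta D E = v → ∃ z, X.delta C E = X.delta C D * z ∧
    (z = v ∨ cs.length z < cs.length v) from H _ E rfl
  intro v
  induction v using reduced_induction_right (cs := cs) with
  | one =>
    intro E h
    rw [X.delta_eq_one_iff] at h
    exact ⟨1, by rw [h, mul_one], Or.inl rfl⟩
  | step i v hlen ih =>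
    intro E h
    obtain ⟨E', h1, h2⟩ := exists_adjacent h
    obtain ⟨z, hz, hz'⟩ := ih E' h2
    have hle : cs.length z ≤ cs.length v := by
      rcases hz' with rfl | hlt
      exacts [le_rfl, hlt.le]
    rcases X.delta_mem_pair C E' E i h1 with h3 | h3
    · refine ⟨z * cs.simple i, by rw [h3, hz, mul_assoc], ?_⟩
      rcases hz' with rfl | hlt
      · exact Or.inl rfl
      · have := cs.length_mul_le z (cs.simple i)
        rw [cs.length_simple] at this
        right; omega
    · exact ⟨z, by rw [h3, hz], by right; omega⟩

lemma gdist_triangle (C D E : X.Chamber) : X.gdist C E ≤ X.gdist C D + X.gdist D E := by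
  obtain ⟨z, hz, hz'⟩ := exists_delta_eq_mul C D E
  have h1 := cs.length_mul_le (X.delta C D) z
  rw [gdist, hz, gdist, gdist]
  rcases hz' with rfl | h <;> omega

lemma delta_mul_of_gdist {C D E : X.Chamber} (h : X.gdist C E = X.gdist C D + X.gdist D E) :
    X.delta C E = X.delta C D * X.delta D E := by
  obtain ⟨z, hz, rfl | hlt⟩ := exists_delta_eq_mul C D E
  · exact hz
  · have h1 := cs.length_mul_le (X.delta C D) z
    rw [gdist, gdist, gdist, hz] at h
    omega

/-! ### Residues and gates -/

lemma exists_delta_eq_mul_of_mem_parabolic {J : Set B} (C : X.Chamber) {D E : X.Chamber}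
    (h : X.delta D E ∈ cs.parabolic J) : ∃ u ∈ cs.parabolic J, X.delta C E = X.delta C D * u := by
  suffices H : ∀ v ∈ cs.parabolic J, ∀ E, X.delta D E = v →
      ∃ u ∈ cs.parabolic J, X.delta C E = X.delta C D * u from H _ h E rfl
  intro v hv
  refine parabolic_induction_right (cs := cs) (p := fun v => ∀ E, X.delta D E = v →
    ∃ u ∈ cs.parabolic J, X.delta C E = X.delta C D * u) ?_ ?_ hv
  · intro E hE
    rw [X.delta_eq_one_iff] at hE
    exact ⟨1, one_mem _, by rw [hE, mul_one]⟩
  · intro i hi v _ _ ih E hE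
    obtain ⟨E', h1, h2⟩ := exists_adjacent hE
    obtain ⟨u, hu, he⟩ := ih E' h2
    rcases X.delta_mem_pair C E' E i h1 with h3 | h3
    · exact ⟨u * cs.simple i, mul_mem hu (simple_mem_parabolic hi), by rw [h3, he, mul_assoc]⟩
    · exact ⟨u, hu, by rw [h3, he]⟩

lemma exists_delta_eq_mul_mem {J : Set B} (C D : X.Chamber) {u : W} (hu : u ∈ cs.parabolic J) :
    ∃ E, X.delta D E ∈ cs.parabolic J ∧ X.delta C E = X.delta C D * u := by
  refine parabolic_induction_right (cs := cs)
    (p := fun u => ∃ E, X.delta D E ∈ cs.parabolic J ∧ X.delta C E = X.delta C D * u)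
    ⟨D, by rw [delta_self]; exact one_mem _, by rw [mul_one]⟩ ?_ hu
  rintro i hi u hu - ⟨E, hE, hCE⟩
  obtain ⟨E', h1, h2⟩ := X.exists_delta C E i
  refine ⟨E', ?_, by rw [h2, hCE, mul_assoc]⟩
  rcases X.delta_mem_pair D E E' i h1 with h | h
  · rw [h]; exact mul_mem hE (simple_mem_parabolic hi)
  · rwa [h]

lemma mem_residue {I : Set B} {C D : X.Chamber} :
    D ∈ X.residue I C ↔ X.delta C D ∈ cs.parabolic I := Iff.rfl

lemma mem_residue_self (I : Set B) (C : X.Chamber) : C ∈ X.residue I C := by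
  rw [mem_residue, delta_self]; exact one_mem _

lemma delta_mem_parabolic_trans {I : Set B} {C D E : X.Chamber}
    (h : X.delta C D ∈ cs.parabolic I) (h' : X.delta D E ∈ cs.parabolic I) :
    X.delta C E ∈ cs.parabolic I := by
  obtain ⟨u, hu, he⟩ := exists_delta_eq_mul_of_mem_parabolic C h'
  rw [he]; exact mul_mem h hu

lemma delta_mem_parabolic_swap {I : Set B} {C D : X.Chamber}
    (h : X.delta C D ∈ cs.parabolic I) : X.delta D C ∈ cs.parabolic I := by
  rw [delta_swap]; exact inv_mem h

lemma residue_eq {I : Set B} {C D : X.Chamber} (h : D ∈ X.residue I C) :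
    X.residue I C = X.residue I D := by
  ext E
  exact ⟨delta_mem_parabolic_trans (delta_mem_parabolic_swap h), delta_mem_parabolic_trans h⟩

/-- `D` is the gate of `R` as seen from `C`. -/
def IsGate (X : Bldg cs) (R : Set X.Chamber) (C D : X.Chamber) : Prop :=
  D ∈ R ∧ ∀ E ∈ R, X.gdist C E = X.gdist C D + X.gdist D E

lemma isGate_residue_iff (I : Set B) (C D : X.Chamber) :
    X.IsGate (X.residue I D) C D ↔ cs.IsLeftMin I (X.delta D C) := by
  constructor
  · intro h v hv
    obtain ⟨E, hE, hCE⟩ := exists_delta_eq_mul_mem C D (inv_mem hv)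
    have h1 := h.2 E hE
    rw [gdist, hCE, gdist, delta_swap D C, ← mul_inv_rev, cs.length_inv, cs.length_inv] at h1
    omega
  · intro h
    refine ⟨mem_residue_self I D, fun E hE => ?_⟩
    have h1 := h.length_mul (delta_mem_parabolic_swap hE)
    rw [gdist_swap C E, gdist, delta_mul_of_length h1, h1, gdist_swap C D, gdist_swap D E,
      gdist, gdist, add_comm]

lemma exists_isGate (I : Set B) (C D : X.Chamber) : ∃ E, X.IsGate (X.residue I D) C E := by
  obtain ⟨v, hv, hmin⟩ := exists_isLeftMin (cs := cs) I (X.delta D C)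
  obtain ⟨E, hE, hCE⟩ := exists_delta_eq_mul_mem C D hv
  refine ⟨E, ?_⟩
  rw [residue_eq (D := E) hE, isGate_residue_iff, delta_swap C E, hCE, mul_inv_rev,
    ← delta_swap C D]
  exact hmin

lemma IsGate.eq {R : Set X.Chamber} {C D E : X.Chamber} (h : X.IsGate R C D)
    (h' : X.IsGate R C E) : D = E := by
  have h1 := h.2 E h'.1
  have h2 := h'.2 D h.1
  exact eq_of_gdist_eq_zero (by omega)

lemma IsGate.gate_eq {R : Set X.Chamber} {C D : X.Chamber} (h : X.IsGate R C D) :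
    X.gate R C = D :=
  IsGate.eq (Classical.epsilon_spec (p := X.IsGate R C) ⟨D, h⟩) h

lemma isGate_gate (R : X.Res) (C : X.Chamber) : X.IsGate R.1 C (X.gate R.1 C) := by
  obtain ⟨I, D, -, hR⟩ := R.2
  refine Classical.epsilon_spec (p := X.IsGate R.1 C) ?_
  rw [hR]
  exact exists_isGate I C D

lemma isSphResidue_projSet (R T : X.Res) : X.IsSphResidue (X.projSet R.1 T.1) := by
  obtain ⟨I, c₀, hI, hR⟩ := R.2
  obtain ⟨J, t, -, hT⟩ := T.2
  set c := X.gate R.1 t with hc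
  have hgate : X.IsGate R.1 t c := isGate_gate R t
  have hRc : R.1 = X.residue I c := by
    rw [hR]; exact residue_eq (hR ▸ hgate.1)
  set w := X.delta c t with hw
  have hmin : cs.IsLeftMin I w := by
    rw [hRc] at hgate
    exact (isGate_residue_iff I t c).1 hgate
  set K : Set B := {i ∈ I | w⁻¹ * cs.simple i * w ∈ cs.parabolic J} with hK
  have hKI : cs.parabolic K ≤ cs.parabolic I := parabolic_mono fun i hi => hi.1
  refine ⟨K, c, hI.subset hKI, Set.Subset.antisymm ?_ ?_⟩
  · rintro _ ⟨t', ht', rfl⟩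
    rw [hT] at ht'
    have hd := isGate_gate R t'
    set d := X.gate R.1 t'
    have hcd : X.delta c d ∈ cs.parabolic I := by
      have := hd.1
      rwa [hRc] at this
    obtain ⟨u, hu, hcu⟩ := exists_delta_eq_mul_of_mem_parabolic c ht'
    obtain ⟨v, hv, hy⟩ := hmin.exists_mem_parabolic hu
    have hx : cs.IsLeftMin I (X.delta d t') := by
      rw [hRc, residue_eq hcd] at hd
      exact (isGate_residue_iff I t' d).1 hd
    have hct : X.delta c t' = X.delta c d * X.delta d t' := by
      apply delta_mul_of_length
      exact hx.length_mul hcd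
    have hxy : (X.delta c d)⁻¹ * v * (v⁻¹ * w * u) = X.delta d t' := by
      rw [mul_assoc, mul_assoc v⁻¹, mul_inv_cancel_left, hw, ← hcu, hct, inv_mul_cancel_left]
    have h1 := hy.eq_one_of_mul (mul_mem (inv_mem hcd) (hKI hv)) (hxy ▸ hx)
    rw [inv_mul_eq_one] at h1
    rw [mem_residue, h1]
    exact hv
  · intro d hd
    have hdI : X.delta c d ∈ cs.parabolic I := hKI hd
    have hdt : X.delta d t = (X.delta c d)⁻¹ * w := by
      rw [← delta_swap]
      exact delta_mul_of_length (hmin.length_mul (delta_mem_parabolic_swap hdI))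
    have hconj : w⁻¹ * X.delta c d * w ∈ cs.parabolic J :=
      conj_mem_parabolic (fun k hk => hk.2) hd
    obtain ⟨t', ht', hdt'⟩ := exists_delta_eq_mul_mem d t hconj
    refine ⟨t', by rw [hT]; exact ht', IsGate.gate_eq ?_⟩
    have hdw : X.delta d t' = w := by rw [hdt', hdt]; group
    rw [hRc, residue_eq hdI, isGate_residue_iff, hdw]
    exact hmin

lemma projRes_val (R T : X.Res) : (X.projRes R T).1 = X.projSet R.1 T.1 :=
  Classical.epsilon_spec (p := fun U : X.Res => U.1 = X.projSet R.1 T.1)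
    ⟨⟨_, isSphResidue_projSet R T⟩, rfl⟩

/-! ### Convexity of gallery intervals -/

/-- If `δ(c,y) δ(y,t) = δ(c,t)`, then a first step of a minimal gallery from `c` to `t` changes the
Weyl distance to `y` as it does in an apartment. -/
lemma delta_simple_mul_of_consistent {c y t c' : X.Chamber} {i : B}
    (h : X.delta c t = X.delta c y * X.delta y t) (hc : X.delta c c' = cs.simple i)
    (ht : X.delta c' t = cs.simple i * X.delta c t)
    (hlt : cs.length (cs.simple i * X.delta c t) < cs.length (X.delta c t)) :
    X.delta c' y = cs.simple i * X.delta c y := by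
  have hc' := delta_swap_of_simple hc
  have hpair : X.delta c' y = cs.simple i * X.delta c y ∨ X.delta c' y = X.delta c y := by
    rw [delta_swap y c', delta_swap y c]
    rcases X.delta_mem_pair y c c' i hc with h1 | h1 <;> rw [h1]
    · left; rw [mul_inv_rev, cs.inv_simple]
    · right; rfl
  rcases hpair with h1 | h1
  · exact h1
  rcases cs.length_simple_mul (X.delta c y) i with hl | hl
  · rw [delta_mul_of_length (C := c') (D := c) (E := y), hc']
    rw [hc', hl, cs.length_simple, add_comm]
  exfalso
  set v := X.delta c y
  set w := X.delta c t
  obtain ⟨z, hz, hz'⟩ := exists_delta_eq_mul c' y t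
  rw [h1, ht, ← inv_mul_eq_iff_eq_mul, ← mul_assoc] at hz
  have hyt : X.delta y t = v⁻¹ * w := by rw [h, inv_mul_cancel_left]
  have hlen := cs.length_inv_mul_lt_of_common_leftDescent (v := v) (by omega) hlt
  rw [hz, ← hyt] at hlen
  rcases hz' with rfl | hz' <;> omega

/-- `x` lies on a minimal gallery from `c` to `t`. -/
def Between (X : Bldg cs) (c x t : X.Chamber) : Prop :=
  X.gdist c t = X.gdist c x + X.gdist x t

lemma Between.swap {c x t : X.Chamber} (h : X.Between c x t) : X.Between t x c := by
  rw [Between, gdist_swap t c, gdist_swap t x, gdist_swap x c, h, add_comm]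

lemma Between.delta_eq {c x t : X.Chamber} (h : X.Between c x t) :
    X.delta c t = X.delta c x * X.delta x t := delta_mul_of_gdist h

lemma between_left (c t : X.Chamber) : X.Between c c t := by rw [Between, gdist_self, zero_add]

lemma between_right (c t : X.Chamber) : X.Between c t t := by rw [Between, gdist_self, add_zero]

/-- The first step of a minimal gallery from `c` to `t` passing through `x`. -/
lemma Between.exists_first_step {c x t : X.Chamber} (h : X.Between c x t) {i : B} {u : W}
    (hx : X.delta c x = cs.simple i * u) (hlen : cs.length (cs.simple i * u) = cs.length u + 1) :
    ∃ c', X.delta c c' = cs.simple i ∧ X.delta c' x = u ∧ X.Between c' x t ∧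
      X.delta c' t = cs.simple i * X.delta c t ∧
      cs.length (cs.simple i * X.delta c t) < cs.length (X.delta c t) := by
  have hx' : X.delta x c = u⁻¹ * cs.simple i := by
    rw [delta_swap c x, hx, mul_inv_rev, cs.inv_simple]
  obtain ⟨c', h1, h2⟩ := exists_adjacent hx'
  have h3 : X.delta c c' = cs.simple i := delta_swap_of_simple h1
  have h4 : X.delta c' x = u := by rw [delta_swap x c', h2, inv_inv]
  have h5 : X.gdist c' x = cs.length u := by rw [gdist, h4]
  have h6 : X.gdist c x = cs.length u + 1 := by rw [gdist, hx, hlen]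
  have h7 : X.gdist c c' = 1 := by rw [gdist, h3, cs.length_simple]
  have h8 := gdist_triangle c c' t
  have h9 := gdist_triangle c' x t
  have hb : X.Between c' x t := by
    unfold Between at h ⊢
    omega
  have h10 : X.delta c' t = cs.simple i * X.delta c t := by
    rw [hb.delta_eq, h.delta_eq, h4, hx, mul_assoc, cs.simple_mul_simple_cancel_left]
  refine ⟨c', h3, h4, hb, h10, ?_⟩
  rw [← h10]
  change X.gdist c' t < X.gdist c t
  unfold Between at h hb
  omega

lemma delta_eq_mul_of_consistent {c x y t : X.Chamber}
    (h : X.delta c t = X.delta c y * X.delta y t) (hx : X.Between c x t) :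
    X.delta c y = X.delta c x * X.delta x y := by
  suffices H : ∀ u c, X.delta c x = u → X.delta c t = X.delta c y * X.delta y t →
      X.Between c x t → X.delta c y = u * X.delta x y from H _ c rfl h hx
  intro u
  induction u using reduced_induction_left (cs := cs) with
  | one =>
    intro c hc _ _
    rw [X.delta_eq_one_iff] at hc
    rw [hc, one_mul]
  | step i u hlen ih =>
    intro c hc hcons hb
    obtain ⟨c', h1, h2, h3, h4, h5⟩ := hb.exists_first_step hc hlen
    have h6 := delta_simple_mul_of_consistent hcons h1 h4 h5
    have h7 := ih c' h2 (by rw [h4, h6, hcons, mul_assoc]) h3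
    rw [mul_assoc, ← h7, h6, cs.simple_mul_simple_cancel_left]

lemma Between.between_step {c x y t x' : X.Chamber} {i : B} (hx : X.Between c x t)
    (hy : X.Between c y t) (hx' : X.delta x x' = cs.simple i)
    (hx'y : X.delta x' y = cs.simple i * X.delta x y)
    (hlt : cs.length (cs.simple i * X.delta x y) < cs.length (X.delta x y)) :
    X.Between c x' t := by
  have hc : X.delta x y = X.delta x c * X.delta c y := by
    rw [delta_eq_mul_of_consistent hy.delta_eq hx, delta_swap c x, inv_mul_cancel_left]
  have ht : X.delta x y = X.delta x t * X.delta t y := by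
    rw [delta_eq_mul_of_consistent hy.swap.delta_eq hx.swap, delta_swap t x, inv_mul_cancel_left]
  have hc' := delta_simple_mul_of_consistent hc hx' hx'y hlt
  have ht' := delta_simple_mul_of_consistent ht hx' hx'y hlt
  have hct : X.delta c t = (X.delta x c)⁻¹ * X.delta x t := by
    rw [hx.delta_eq, delta_swap x c]
  have htri := gdist_triangle c x' t
  have e1 : X.gdist c x' = cs.length (cs.simple i * X.delta x c) := by
    rw [gdist_swap, gdist, hc']
  have e2 : X.gdist x' t = cs.length (cs.simple i * X.delta x t) := by rw [gdist, ht']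
  have e3 : X.gdist c x = cs.length (X.delta x c) := by rw [gdist_swap, gdist]
  have e4 : X.gdist x t = cs.length (X.delta x t) := rfl
  have hx0 := hx
  unfold Between at hx ⊢
  rcases cs.length_simple_mul (X.delta x c) i with l1 | l1 <;>
    rcases cs.length_simple_mul (X.delta x t) i with l2 | l2
  · exfalso
    set p := X.delta x c
    set q := X.delta x t
    have hr : cs.IsReflection (p⁻¹ * cs.simple i * p) := by
      simpa using (cs.isReflection_simple i).conj p⁻¹
    have h1 := (cs.length_reflection_mul_lt_iff (cs.isReflection_simple i) p (X.delta c y)).1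
      (by rw [← hc]; exact hlt)
    have h2 : cs.length (p⁻¹ * cs.simple i * p * X.delta c y) < cs.length (X.delta c y) := by
      by_contra h2
      exact h1 (iff_of_false (by omega) h2)
    have h3 : cs.length (p⁻¹ * cs.simple i * p * X.delta c t) < cs.length (X.delta c t) := by
      have h4 := cs.length_mul_le (p⁻¹ * cs.simple i * p * X.delta c y) (X.delta y t)
      rw [mul_assoc, ← hy.delta_eq] at h4
      have h5 : X.gdist c t = X.gdist c y + X.gdist y t := hy
      unfold gdist at h5
      omega
    rw [hct, cs.length_reflection_mul_lt_iff hr] at h3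
    refine h3 (iff_of_false ?_ ?_)
    · rw [mul_inv_cancel_right, ← cs.length_inv, mul_inv_rev, inv_inv, cs.inv_simple,
        cs.length_inv]
      omega
    · have h6 : p⁻¹⁻¹ * (p⁻¹ * cs.simple i * p) * p⁻¹ * q = cs.simple i * q := by group
      rw [h6]
      omega
  all_goals omega

/-- Gallery intervals are convex. -/
lemma Between.convex {c x y z t : X.Chamber} (hx : X.Between c x t) (hy : X.Between c y t)
    (hz : X.Between x z y) : X.Between c z t := by
  suffices H : ∀ u x, X.delta x z = u → X.Between c x t → X.Between x z y → X.Between c z t from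
    H _ x rfl hx hz
  intro u
  induction u using reduced_induction_left (cs := cs) with
  | one =>
    intro x h hx _
    rw [X.delta_eq_one_iff] at h
    rwa [← h]
  | step i u hlen ih =>
    intro x h hx hz
    obtain ⟨x', h1, h2, h3, h4, h5⟩ := hz.exists_first_step h hlen
    exact ih x' h2 (hx.between_step hy h1 h4 h5) h3

/-- The residues meeting a gallery interval form a convex set. -/
lemma convexResSet_between (c t : X.Chamber) :
    X.ConvexResSet {σ | ∃ d ∈ σ.1, X.Between c d t} := by
  refine ⟨?_, ?_⟩
  · rintro R₁ R₂ hle ⟨d, hd, hb⟩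
    exact ⟨d, hle hd, hb⟩
  · rintro R₁ ⟨d₁, hd₁, hb₁⟩ R₂ ⟨d₂, hd₂, hb₂⟩
    refine ⟨X.gate R₁.1 d₂, ?_, ?_⟩
    · rw [projRes_val]
      exact ⟨d₂, hd₂, rfl⟩
    · exact hb₂.convex hb₁ ((isGate_gate R₁ d₂).2 d₁ hd₁)

end Bldg

/-- `proj_R(T)` is the unique maximal spherical residue containing `R`
and belonging to the convex hull `Conv(R,T)`. -/
theorem statement1 {cs : CoxeterSystem M W} (X : Bldg cs) (R T : X.Res) :
    X.projRes R T ∈ X.conv2 R T ∧ X.leRes R (X.projRes R T) ∧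
    ∀ σ ∈ X.conv2 R T, X.leRes R σ → X.leRes σ (X.projRes R T) := by
  refine ⟨?_, ?_, ?_⟩
  · rintro 𝓢 ⟨hconv, hsub⟩
    exact hconv.2 R (hsub (Or.inl rfl)) T (hsub (Or.inr rfl))
  · rw [Bldg.leRes, Bldg.projRes_val]
    rintro _ ⟨t, _, rfl⟩
    exact (Bldg.isGate_gate R t).1
  · intro σ hσ hRσ
    rw [Bldg.leRes, Bldg.projRes_val]
    rintro _ ⟨t, ht, rfl⟩
    have hg := Bldg.isGate_gate R t
    obtain ⟨d, hd, hb⟩ : ∃ d ∈ σ.1, X.Between (X.gate R.1 t) d t := by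
      refine hσ _ ⟨Bldg.convexResSet_between _ t, ?_⟩
      rintro ρ (rfl | rfl)
      · exact ⟨_, hg.1, Bldg.between_left _ _⟩
      · exact ⟨t, ht, Bldg.between_right _ _⟩
    have h1 := hg.2 d (hRσ hd)
    rw [Bldg.Between, Bldg.gdist_swap _ t, Bldg.gdist_swap d t] at hb
    rw [Bldg.eq_of_gdist_eq_zero (C := X.gate R.1 t) (D := d) (by omega)]
    exact hd
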